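/- arXiv:2108.06657 — 2 statements merged into one kernel-verified Lean document; each statement's English description precedes it below -/
import Mathlib

section
/- Let v be the (unique up to scalar) nonzero element of (A_s^+)_i ∩ ker e_{-1} for even i with 2 ≤ i ≤ p−1. If l + i ≤ p, then the degree-(l+i) graded component of the W(1)-submodule generated by v has dimension ⌊l/2⌋ + 1. -/
set_option synthInstance.maxHeartbeats 1000000
set_option maxHeartbeats 1000000

/-- The action of the Witt-algebra basis element `e_j = x^{j+1}∂` on
`A(1) = k[X]/(X^p)`, in coordinates w.r.t. the monomial basis `x^0, …, x^{p-1}`: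
`e_j · x^a = a·x^{a+j}` (terms with exponent out of range `[0, p-1]` vanish). -/
noncomputable def wittOp1 (p : ℕ) (k : Type) [Field k] (j : ℤ) :
    (Fin p → k) →ₗ[k] (Fin p → k) :=
  Matrix.toLin' (Matrix.of fun m r : Fin p =>
    if (r : ℤ) = (m : ℤ) - j then (((m : ℤ) - j : ℤ) : k) else 0)

/-- The action of the Witt-algebra basis element `e_j` on
`A_{(2)} = k[X₁,X₂]/(X₁^p, X₂^p)`, in coordinates w.r.t. the monomial basis
`x₁^a x₂^b`: `e_j · f = x₁^{j+1} ∂f/∂x₁ + x₂^{j+1} ∂f/∂x₂`, i.e.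
`e_j · (x₁^a x₂^b) = a·x₁^{a+j}x₂^b + b·x₁^a x₂^{b+j}` (out-of-range terms vanish). -/
noncomputable def wittOp2 (p : ℕ) (k : Type) [Field k] (j : ℤ) :
    (Fin p × Fin p → k) →ₗ[k] (Fin p × Fin p → k) :=
  Matrix.toLin' (Matrix.of fun q r : Fin p × Fin p =>
    (if (r.1 : ℤ) = (q.1 : ℤ) - j ∧ r.2 = q.2 then (((q.1 : ℤ) - j : ℤ) : k) else 0) +
    (if r.1 = q.1 ∧ (r.2 : ℤ) = (q.2 : ℤ) - j then (((q.2 : ℤ) - j : ℤ) : k) else 0))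

/-- The degree-`i` graded component `A_i` of `A_{(2)}`: the span of the monomials
`x₁^a x₂^b` with `a + b = i`. -/
def degComp (p : ℕ) (k : Type) [Field k] (i : ℕ) : Submodule k (Fin p × Fin p → k) where
  carrier := {f | ∀ q : Fin p × Fin p, (q.1 : ℕ) + (q.2 : ℕ) ≠ i → f q = 0}
  add_mem' := by intro f g hf hg q hq; simp [hf q hq, hg q hq]
  zero_mem' := by intro q hq; rfl
  smul_mem' := by intro c f hf q hq; simp [hf q hq]

/-- The symmetric part `A_s` of `A_{(2)} = A(1) ⊗ A(1)`: polynomials invariant under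
swapping `x₁` and `x₂`. -/
def symmPart (p : ℕ) (k : Type) [Field k] : Submodule k (Fin p × Fin p → k) where
  carrier := {f | ∀ q : Fin p × Fin p, f (q.2, q.1) = f q}
  add_mem' := by intro f g hf hg q; simp [hf q, hg q]
  zero_mem' := by intro q; rfl
  smul_mem' := by intro c f hf q; simp [hf q]

/-- The antisymmetric part `A_a` of `A_{(2)} = A(1) ⊗ A(1)`: polynomials negated by
swapping `x₁` and `x₂`. -/
def antisymmPart (p : ℕ) (k : Type) [Field k] : Submodule k (Fin p × Fin p → k) where
  carrier := {f | ∀ q : Fin p × Fin p, f (q.2, q.1) = - f q}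
  add_mem' := by intro f g hf hg q; simp only [Set.mem_setOf_eq] at *;
                 simp [hf q, hg q]; ring
  zero_mem' := by intro q; simp
  smul_mem' := by intro c f hf q; simp only [Set.mem_setOf_eq] at *; simp [hf q]

/-- The monomial `x₁^a x₂^b` of `A_{(2)}` (for `a, b ≤ p-1`), as a coordinate
function. -/
def mono (p : ℕ) (k : Type) [Field k] (a b : ℕ) : Fin p × Fin p → k :=
  fun q => if (q.1 : ℕ) = a ∧ (q.2 : ℕ) = b then 1 else 0

/-- The submodule `A_s' = span{x₁^i + x₂^i : 0 ≤ i ≤ p-1}` of `A_{(2)}`. -/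
noncomputable def symmPrime (p : ℕ) (k : Type) [Field k] : Submodule k (Fin p × Fin p → k) :=
  Submodule.span k (Set.range fun i : Fin p => mono p k i 0 + mono p k 0 i)

/-- The submodule `A_a' = span{x₁^i − x₂^i : 1 ≤ i ≤ p-1}` of `A_{(2)}`. -/
noncomputable def antisymmPrime (p : ℕ) (k : Type) [Field k] : Submodule k (Fin p × Fin p → k) :=
  Submodule.span k {g | ∃ i : Fin p, (i : ℕ) ≠ 0 ∧ g = mono p k i 0 - mono p k 0 i}

open MvPolynomial in
/-- The Witt derivation `x₁^t ∂₁ + x₂^t ∂₂` of the polynomial ring in two variables. -/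
noncomputable def wittDerivation (k : Type) [Field k] (t : ℕ) :
    Derivation k (MvPolynomial (Fin 2) k) (MvPolynomial (Fin 2) k) :=
  mkDerivation k fun i => X i ^ t

/-- The exponent vector `(a, b)`. -/
noncomputable def biExponent (a b : ℕ) : Fin 2 →₀ ℕ :=
  Finsupp.single 0 a + Finsupp.single 1 b

@[simp] lemma biExponent_zero (a b : ℕ) : biExponent a b 0 = a := by simp [biExponent]

@[simp] lemma biExponent_one (a b : ℕ) : biExponent a b 1 = b := by simp [biExponent]

lemma biExponent_eta (m : Fin 2 →₀ ℕ) : biExponent (m 0) (m 1) = m := by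
  ext i; fin_cases i <;> simp

lemma biExponent_inj {a b c d : ℕ} : biExponent a b = biExponent c d ↔ a = c ∧ b = d := by
  constructor
  · intro h
    exact ⟨by simpa using DFunLike.congr_fun h 0, by simpa using DFunLike.congr_fun h 1⟩
  · rintro ⟨rfl, rfl⟩; rfl

/-- The truncation map `k[x₁, x₂] → A_{(2)}`. -/
noncomputable def truncation (p : ℕ) (k : Type) [Field k] :
    MvPolynomial (Fin 2) k →ₗ[k] (Fin p × Fin p → k) :=
  LinearMap.pi fun q => MvPolynomial.lcoeff k (biExponent q.1 q.2)

lemma truncation_apply (p : ℕ) (k : Type) [Field k] (f : MvPolynomial (Fin 2) k)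
    (q : Fin p × Fin p) : truncation p k f q = f.coeff (biExponent q.1 q.2) := rfl

lemma wittOp2_apply (p : ℕ) (k : Type) [Field k] (t : ℕ) (f : Fin p × Fin p → k)
    (q : Fin p × Fin p) :
    wittOp2 p k ((t : ℤ) - 1) f q =
      (if h : t ≤ q.1 + 1 ∧ (q.1 : ℕ) + 1 - t < p then
        (((q.1 : ℕ) + 1 - t : ℕ) : k) * f (⟨q.1 + 1 - t, h.2⟩, q.2) else 0) +
      (if h : t ≤ q.2 + 1 ∧ (q.2 : ℕ) + 1 - t < p then
        (((q.2 : ℕ) + 1 - t : ℕ) : k) * f (q.1, ⟨q.2 + 1 - t, h.2⟩) else 0) := by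
  simp only [wittOp2, Matrix.toLin'_apply, Matrix.mulVec, dotProduct, Matrix.of_apply, add_mul,
    Finset.sum_add_distrib]
  congr 1
  · split_ifs with h
    · rw [Finset.sum_eq_single (⟨q.1 + 1 - t, h.2⟩, q.2)]
      · rw [if_pos ⟨by simp; omega, rfl⟩]
        congr 1
        rw [Nat.cast_sub h.1]; push_cast; ring
      · rintro ⟨a, b⟩ - hne
        rw [if_neg, zero_mul]
        rintro ⟨h1, h2⟩
        apply hne
        simp only [Prod.mk.injEq, Fin.ext_iff] at *
        omega
      · simp
    · apply Finset.sum_eq_zero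
      rintro ⟨a, b⟩ -
      rw [if_neg, zero_mul]
      rintro ⟨h1, h2⟩
      simp only at *
      omega
  · split_ifs with h
    · rw [Finset.sum_eq_single (q.1, ⟨q.2 + 1 - t, h.2⟩)]
      · rw [if_pos ⟨rfl, by simp; omega⟩]
        congr 1
        rw [Nat.cast_sub h.1]; push_cast; ring
      · rintro ⟨a, b⟩ - hne
        rw [if_neg, zero_mul]
        rintro ⟨h1, h2⟩
        apply hne
        simp only [Prod.mk.injEq, Fin.ext_iff] at *
        omega
      · simp
    · apply Finset.sum_eq_zero
      rintro ⟨a, b⟩ -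
      rw [if_neg, zero_mul]
      rintro ⟨h1, h2⟩
      simp only at *
      omega

lemma wittDerivation_eq (k : Type) [Field k] (t : ℕ) (f : MvPolynomial (Fin 2) k) :
    wittDerivation k t f = MvPolynomial.X 0 ^ t * MvPolynomial.pderiv 0 f +
      MvPolynomial.X 1 ^ t * MvPolynomial.pderiv 1 f := by
  have : wittDerivation k t = (MvPolynomial.X 0 ^ t : MvPolynomial (Fin 2) k) •
      MvPolynomial.pderiv 0 + (MvPolynomial.X 1 ^ t : MvPolynomial (Fin 2) k) •
      MvPolynomial.pderiv 1 := by
    apply MvPolynomial.derivation_ext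
    intro i
    fin_cases i <;> simp [wittDerivation, MvPolynomial.mkDerivation_X]
  rw [this]
  simp

lemma coeff_wittDerivation (k : Type) [Field k] (t : ℕ) (f : MvPolynomial (Fin 2) k) (a b : ℕ) :
    (wittDerivation k t f).coeff (biExponent a b) =
      (if t ≤ a + 1 then ((a + 1 - t : ℕ) : k) * f.coeff (biExponent (a + 1 - t) b) else 0) +
      (if t ≤ b + 1 then ((b + 1 - t : ℕ) : k) * f.coeff (biExponent a (b + 1 - t)) else 0) := by
  induction f using MvPolynomial.induction_on' with
  | add f g hf hg =>
    rw [map_add, MvPolynomial.coeff_add, hf, hg, MvPolynomial.coeff_add, MvPolynomial.coeff_add]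
    split_ifs <;> ring
  | monomial m c =>
    obtain ⟨x, y, rfl⟩ : ∃ x y, m = biExponent x y := ⟨_, _, (biExponent_eta m).symm⟩
    rw [wittDerivation_eq, MvPolynomial.pderiv_monomial, MvPolynomial.pderiv_monomial,
      MvPolynomial.X_pow_eq_monomial, MvPolynomial.X_pow_eq_monomial,
      MvPolynomial.monomial_mul, MvPolynomial.monomial_mul, MvPolynomial.coeff_add]
    have e1 : Finsupp.single (0 : Fin 2) t + (biExponent x y - Finsupp.single 0 1) =
        biExponent (t + (x - 1)) y := by
      ext i; fin_cases i <;> simp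
    have e2 : Finsupp.single (1 : Fin 2) t + (biExponent x y - Finsupp.single 1 1) =
        biExponent x (t + (y - 1)) := by
      ext i; fin_cases i <;> simp
    rw [e1, e2]
    simp only [MvPolynomial.coeff_monomial, biExponent_inj, biExponent_zero, biExponent_one,
      one_mul]
    congr 1
    · rcases x with _ | x
      · rw [Nat.cast_zero, mul_zero, ite_self]
        split_ifs with h1 h2
        · rw [← h2.1]; simp
        · simp
        · rfl
      · split_ifs <;> first | omega | (simp; done) | skip
        rw [mul_comm, show a + 1 - t = x + 1 by omega]
    · rcases y with _ | y
      · rw [Nat.cast_zero, mul_zero, ite_self]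
        split_ifs with h1 h2
        · rw [← h2.2]; simp
        · simp
        · rfl
      · split_ifs <;> first | omega | (simp; done) | skip
        rw [mul_comm, show b + 1 - t = y + 1 by omega]

lemma wittOp2_truncation (p : ℕ) (k : Type) [Field k] [CharP k p] (t : ℕ)
    (f : MvPolynomial (Fin 2) k) :
    wittOp2 p k ((t : ℤ) - 1) (truncation p k f) = truncation p k (wittDerivation k t f) := by
  funext q
  rw [wittOp2_apply, truncation_apply, coeff_wittDerivation]
  simp only [truncation_apply]
  have hcast : ∀ a : Fin p, t ≤ (a : ℕ) + 1 → ¬ ((a : ℕ) + 1 - t < p) →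
      (((a : ℕ) + 1 - t : ℕ) : k) = 0 := by
    intro a h1 h2
    have : (a : ℕ) + 1 - t = p := by omega
    rw [this, CharP.cast_eq_zero]
  congr 1
  · by_cases h1 : t ≤ (q.1 : ℕ) + 1
    · by_cases h2 : (q.1 : ℕ) + 1 - t < p
      · simp [h1, h2]
      · simp [h1, h2, hcast _ h1 h2]
    · simp [h1]
  · by_cases h1 : t ≤ (q.2 : ℕ) + 1
    · by_cases h2 : (q.2 : ℕ) + 1 - t < p
      · simp [h1, h2]
      · simp [h1, h2, hcast _ h1 h2]
    · simp [h1]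

open MvPolynomial in
/-- The products `(x₁ + x₂)^a (x₁ - x₂)^n`. -/
noncomputable def sumDiffProd (k : Type) [Field k] (a n : ℕ) : MvPolynomial (Fin 2) k :=
  (X 0 + X 1) ^ a * (X 0 - X 1) ^ n

lemma sumDiffProd_isHomogeneous (k : Type) [Field k] (a n : ℕ) :
    (sumDiffProd k a n).IsHomogeneous (a + n) := by
  have h0 := MvPolynomial.isHomogeneous_X k (0 : Fin 2)
  have h1 := MvPolynomial.isHomogeneous_X k (1 : Fin 2)
  simpa [sumDiffProd] using ((h0.add h1).pow a).mul ((h0.sub h1).pow n)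

lemma wittDerivation_two_sumDiffProd (k : Type) [Field k] (a n : ℕ) :
    (2 : k) • wittDerivation k 2 (sumDiffProd k (a + 1) n) =
      ((a : k) + 1 + 2 * n) • sumDiffProd k (a + 2) n +
        ((a : k) + 1) • sumDiffProd k a (n + 2) := by
  have hC2 : (MvPolynomial.C (2 : k) : MvPolynomial (Fin 2) k) = 2 := map_ofNat _ 2
  rcases n with _ | n <;>
  simp [sumDiffProd, wittDerivation, Derivation.leibniz, Derivation.leibniz_pow,
      MvPolynomial.mkDerivation_X, MvPolynomial.smul_eq_C_mul, hC2] <;> ring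

lemma wittDerivation_two_diff_pow (k : Type) [Field k] (n : ℕ) :
    wittDerivation k 2 (sumDiffProd k 0 n) = (n : k) • sumDiffProd k 1 n := by
  rcases n with _ | n <;>
  simp [sumDiffProd, wittDerivation, Derivation.leibniz_pow,
      MvPolynomial.mkDerivation_X, MvPolynomial.smul_eq_C_mul]
  left
  ring

lemma wittDerivation_three_sumDiffProd (k : Type) [Field k] (a n : ℕ) :
    (4 : k) • wittDerivation k 3 (sumDiffProd k a n) =
      ((a : k) + 3 * n) • sumDiffProd k (a + 2) n +
        (3 * (a : k) + n) • sumDiffProd k a (n + 2) := by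
  have hC3 : (MvPolynomial.C (3 : k) : MvPolynomial (Fin 2) k) = 3 := map_ofNat _ 3
  have hC4 : (MvPolynomial.C (4 : k) : MvPolynomial (Fin 2) k) = 4 := map_ofNat _ 4
  rcases n with _ | n <;> rcases a with _ | a <;>
  simp [sumDiffProd, wittDerivation, Derivation.leibniz, Derivation.leibniz_pow,
      MvPolynomial.mkDerivation_X, MvPolynomial.smul_eq_C_mul, hC3, hC4] <;> ring

/-- A space of polynomials which contains `(x₁ - x₂)^i` and is stable under `x²∂` and `x³∂`
contains `(x₁ + x₂)^a (x₁ - x₂)^(i + 2m)` as long as the total degree is at most `p`. -/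
lemma sumDiffProd_mem_of_stable {p : ℕ} {k : Type} [Field k] [CharP k p] {i : ℕ} (hi2 : 2 ≤ i)
    (N : Submodule k (MvPolynomial (Fin 2) k)) (h0 : sumDiffProd k 0 i ∈ N)
    (h2 : ∀ f ∈ N, wittDerivation k 2 f ∈ N) (h3 : ∀ f ∈ N, wittDerivation k 3 f ∈ N)
    (l : ℕ) (hl : i + l ≤ p) (a m : ℕ) (ham : a + 2 * m = l) :
    sumDiffProd k a (i + 2 * m) ∈ N := by
  have hne : ∀ n : ℕ, 0 < n → n < p → (n : k) ≠ 0 := by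
    intro n hn hnp h
    rw [CharP.cast_eq_zero_iff k p] at h
    exact absurd (Nat.le_of_dvd hn h) (by omega)
  induction l using Nat.strong_induction_on generalizing a m with
  | _ l ih =>
  have r2 : ∀ a m, a + 2 + 2 * m = l →
      ((a : k) + 1 + 2 * (i + 2 * m : ℕ)) • sumDiffProd k (a + 2) (i + 2 * m) +
        ((a : k) + 1) • sumDiffProd k a (i + 2 * (m + 1)) ∈ N := by
    intro a m h
    have := N.smul_mem (2 : k) (h2 _ (ih (l - 1) (by omega) (by omega) (a + 1) m (by omega)))
    rwa [wittDerivation_two_sumDiffProd] at this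
  have r3 : ∀ a m, a + 2 + 2 * m = l →
      ((a : k) + 3 * (i + 2 * m : ℕ)) • sumDiffProd k (a + 2) (i + 2 * m) +
        (3 * (a : k) + (i + 2 * m : ℕ)) • sumDiffProd k a (i + 2 * (m + 1)) ∈ N := by
    intro a m h
    have := N.smul_mem (4 : k) (h3 _ (ih (l - 2) (by omega) (by omega) a m (by omega)))
    rwa [wittDerivation_three_sumDiffProd] at this
  have step : ∀ a m, a + 2 + 2 * m = l → sumDiffProd k a (i + 2 * (m + 1)) ∈ N →
      sumDiffProd k (a + 2) (i + 2 * m) ∈ N := by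
    intro a m h hmem
    have q2 := (Submodule.add_mem_iff_left _ (N.smul_mem _ hmem)).1 (r2 a m h)
    have q3 := (Submodule.add_mem_iff_left _ (N.smul_mem _ hmem)).1 (r3 a m h)
    have q := N.sub_mem q3 q2
    rw [← sub_smul] at q
    rw [show (a : k) + 3 * (i + 2 * m : ℕ) - (a + 1 + 2 * (i + 2 * m : ℕ)) =
      ((i + 2 * m - 1 : ℕ) : k) by rw [Nat.cast_sub (by omega)]; push_cast; ring] at q
    exact (N.smul_mem_iff (hne _ (by omega) (by omega))).1 q
  induction a using Nat.strong_induction_on generalizing m with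
  | _ a iha =>
  match a, m with
  | 0, 0 => exact h0
  | 1, m =>
    have := h2 _ (ih (l - 1) (by omega) (by omega) 0 m (by omega))
    rw [wittDerivation_two_diff_pow] at this
    exact (N.smul_mem_iff (hne _ (by omega) (by omega))).1 this
  | a + 2, m => exact step a m ham (iha a (by omega) (m + 1) (by omega))
  | 0, m + 1 =>
    have q2 := r2 0 m (by omega)
    have q3 := r3 0 m (by omega)
    have q := N.sub_mem (N.smul_mem ((i + 2 * m : ℕ) : k) q2) q3
    have e : (2 * (((i + 2 * m : ℕ) : k) * ((i + 2 * m - 1 : ℕ) : k))) •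
        sumDiffProd k 2 (i + 2 * m) ∈ N := by
      convert q using 1
      rw [Nat.cast_sub (by omega)]
      simp only [zero_add]
      module
    have h2k : (2 : k) ≠ 0 := by exact_mod_cast hne 2 (by omega) (by omega)
    have e' := (N.smul_mem_iff (mul_ne_zero h2k (mul_ne_zero (hne _ (by omega) (by omega))
      (hne _ (by omega) (by omega))))).1 e
    have := (Submodule.add_mem_iff_right _ (N.smul_mem _ e')).1 q2
    simpa using this

/-- The span of the products `(x₁ + x₂)^a (x₁ - x₂)^(n + 2m)`. -/
noncomputable def sumDiffSpan (k : Type) [Field k] (n : ℕ) :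
    Submodule k (MvPolynomial (Fin 2) k) :=
  Submodule.span k (Set.range fun c : ℕ × ℕ => sumDiffProd k c.1 (n + 2 * c.2))

lemma sumDiffProd_mem_span (k : Type) [Field k] (a n m : ℕ) :
    sumDiffProd k a (n + 2 * m) ∈ sumDiffSpan k n :=
  Submodule.subset_span ⟨(a, m), rfl⟩

lemma sumDiffSpan_add_two_le (k : Type) [Field k] (n : ℕ) :
    sumDiffSpan k (n + 2) ≤ sumDiffSpan k n := by
  refine Submodule.span_le.2 ?_
  rintro _ ⟨⟨a, m⟩, rfl⟩
  have := sumDiffProd_mem_span k a n (m + 1)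
  rwa [show n + 2 * (m + 1) = n + 2 + 2 * m by ring] at this

lemma mul_mem_sumDiffSpan {k : Type} [Field k] {n m r : ℕ} {f g : MvPolynomial (Fin 2) k}
    (hf : f ∈ sumDiffSpan k n) (hg : g ∈ sumDiffSpan k m) (hr : n + m = r) :
    f * g ∈ sumDiffSpan k r := by
  subst hr
  have h := Submodule.mul_mem_mul hf hg
  rw [sumDiffSpan, sumDiffSpan, Submodule.span_mul_span] at h
  refine Submodule.span_le.2 ?_ h
  rintro _ ⟨_, ⟨⟨a, x⟩, rfl⟩, _, ⟨⟨b, y⟩, rfl⟩, rfl⟩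
  have := sumDiffProd_mem_span k (a + b) (n + m) (x + y)
  simp only [SetLike.mem_coe]
  convert this using 1
  simp only [sumDiffProd]
  ring

open MvPolynomial in
lemma powerSum_powerDiff_mem {k : Type} [Field k] (h2 : (2 : k) ≠ 0) (t : ℕ) :
    (X 0 ^ t + X 1 ^ t : MvPolynomial (Fin 2) k) ∈ sumDiffSpan k 0 ∧
      (X 0 ^ t - X 1 ^ t : MvPolynomial (Fin 2) k) ∈ sumDiffSpan k 1 := by
  have hC2 : (C (2 : k) : MvPolynomial (Fin 2) k) = 2 := map_ofNat _ 2
  have hs : (X 0 + X 1 : MvPolynomial (Fin 2) k) ∈ sumDiffSpan k 0 := by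
    simpa [sumDiffProd] using sumDiffProd_mem_span k 1 0 0
  have hd : (X 0 - X 1 : MvPolynomial (Fin 2) k) ∈ sumDiffSpan k 1 := by
    simpa [sumDiffProd] using sumDiffProd_mem_span k 0 1 0
  induction t with
  | zero =>
    refine ⟨?_, by simp⟩
    have := (sumDiffSpan k 0).smul_mem (2 : k) (sumDiffProd_mem_span k 0 0 0)
    simp only [sumDiffProd, smul_eq_C_mul, hC2] at this
    convert this using 1
    ring
  | succ t ih =>
    constructor
    · refine ((sumDiffSpan k 0).smul_mem_iff h2).1 ?_
      have := add_mem (mul_mem_sumDiffSpan hs ih.1 (zero_add 0))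
        (sumDiffSpan_add_two_le k 0 (mul_mem_sumDiffSpan hd ih.2 rfl))
      convert this using 1
      rw [smul_eq_C_mul, hC2]
      ring
    · refine ((sumDiffSpan k 1).smul_mem_iff h2).1 ?_
      have := add_mem (mul_mem_sumDiffSpan hs ih.2 (zero_add 1))
        (mul_mem_sumDiffSpan hd ih.1 (add_zero 1))
      convert this using 1
      rw [smul_eq_C_mul, hC2]
      ring

lemma wittDerivation_mem_sumDiffSpan {k : Type} [Field k] (h2 : (2 : k) ≠ 0) (t n : ℕ)
    {f : MvPolynomial (Fin 2) k} (hf : f ∈ sumDiffSpan k n) :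
    wittDerivation k t f ∈ sumDiffSpan k n := by
  have key : ∀ a n, wittDerivation k t (sumDiffProd k a n) ∈ sumDiffSpan k n := by
    intro a n
    have h1 : (a : k) • (sumDiffProd k (a - 1) n *
        (MvPolynomial.X 0 ^ t + MvPolynomial.X 1 ^ t)) ∈ sumDiffSpan k n :=
      Submodule.smul_mem _ _ (mul_mem_sumDiffSpan (sumDiffProd_mem_span k (a - 1) n 0)
        (powerSum_powerDiff_mem h2 t).1 (add_zero n))
    have h3 : (n : k) • (sumDiffProd k a (n - 1) *
        (MvPolynomial.X 0 ^ t - MvPolynomial.X 1 ^ t)) ∈ sumDiffSpan k n := by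
      rcases n with _ | n
      · simp
      · exact Submodule.smul_mem _ _ (mul_mem_sumDiffSpan (sumDiffProd_mem_span k a n 0)
          (powerSum_powerDiff_mem h2 t).2 rfl)
    convert add_mem h1 h3 using 1
    simp only [sumDiffProd, wittDerivation, Derivation.leibniz, Derivation.leibniz_pow,
      map_add, map_sub, MvPolynomial.mkDerivation_X, MvPolynomial.smul_eq_C_mul, nsmul_eq_mul,
      smul_eq_mul, map_natCast]
    ring
  induction hf using Submodule.span_induction with
  | mem x hx =>
    obtain ⟨⟨a, m⟩, rfl⟩ := hx
    have h : ∀ m n, sumDiffSpan k (n + 2 * m) ≤ sumDiffSpan k n := by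
      intro m n
      induction m with
      | zero => exact le_rfl
      | succ m ih => exact (sumDiffSpan_add_two_le k (n + 2 * m)).trans ih
    exact h m n (key a _)
  | zero => simp
  | add x y _ _ hx hy => rw [map_add]; exact add_mem hx hy
  | smul c x _ hx => rw [Derivation.map_smul]; exact Submodule.smul_mem _ _ hx

lemma homogeneousComponent_mem_of_mem_sumDiffSpan {k : Type} [Field k] (i l : ℕ)
    {f : MvPolynomial (Fin 2) k} (hf : f ∈ sumDiffSpan k i) :
    MvPolynomial.homogeneousComponent (i + l) f ∈ Submodule.span k
      (Set.range fun m : Fin (l / 2 + 1) => sumDiffProd k (l - 2 * m) (i + 2 * m)) := by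
  induction hf using Submodule.span_induction with
  | mem x hx =>
    obtain ⟨⟨a, m⟩, rfl⟩ := hx
    rw [MvPolynomial.homogeneousComponent_of_mem (sumDiffProd_isHomogeneous k _ _)]
    split_ifs with h
    · refine Submodule.subset_span ⟨⟨m, by omega⟩, ?_⟩
      simp only
      congr 1
      omega
    · exact zero_mem _
  | zero => simp
  | add x y _ _ hx hy => rw [map_add]; exact add_mem hx hy
  | smul c x _ hx => rw [map_smul]; exact Submodule.smul_mem _ _ hx

lemma apply_eq_zero_of_mem_symmPrime {p : ℕ} {k : Type} [Field k] {f : Fin p × Fin p → k}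
    (hf : f ∈ symmPrime p k) (q : Fin p × Fin p) (h1 : (q.1 : ℕ) ≠ 0) (h2 : (q.2 : ℕ) ≠ 0) :
    f q = 0 := by
  induction hf using Submodule.span_induction with
  | mem x hx =>
    obtain ⟨i, rfl⟩ := hx
    simp [mono, h1, h2]
  | zero => rfl
  | add x y _ _ hx hy => rw [Pi.add_apply, hx, hy, add_zero]
  | smul c x _ hx => rw [Pi.smul_apply, hx, smul_zero]

/-- The projection of `A_{(2)}` onto its component of degree `n`. -/
def degProj (p : ℕ) (k : Type) [Field k] (n : ℕ) :
    (Fin p × Fin p → k) →ₗ[k] (Fin p × Fin p → k) :=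
  LinearMap.pi fun q => if (q.1 : ℕ) + q.2 = n then LinearMap.proj q else 0

lemma degProj_apply (p : ℕ) (k : Type) [Field k] (n : ℕ) (f : Fin p × Fin p → k)
    (q : Fin p × Fin p) : degProj p k n f q = if (q.1 : ℕ) + q.2 = n then f q else 0 := by
  simp only [degProj, LinearMap.pi_apply]
  split_ifs <;> rfl

lemma degProj_truncation (p : ℕ) (k : Type) [Field k] (n : ℕ) (f : MvPolynomial (Fin 2) k) :
    degProj p k n (truncation p k f) =
      truncation p k (MvPolynomial.homogeneousComponent n f) := by
  funext q
  rw [degProj_apply, truncation_apply, truncation_apply,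
    MvPolynomial.coeff_homogeneousComponent]
  simp [biExponent, map_add]

lemma degProj_of_mem_degComp {p : ℕ} {k : Type} [Field k] {n : ℕ} {f : Fin p × Fin p → k}
    (hf : f ∈ degComp p k n) : degProj p k n f = f := by
  funext q
  rw [degProj_apply]
  split_ifs with h
  · rfl
  · exact (hf q h).symm

lemma truncation_mem_degComp {p : ℕ} {k : Type} [Field k] {n : ℕ} {f : MvPolynomial (Fin 2) k}
    (hf : f.IsHomogeneous n) : truncation p k f ∈ degComp p k n := by
  intro q hq
  rw [truncation_apply]
  apply hf.coeff_eq_zero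
  simpa [biExponent, map_add] using hq

lemma degProj_mem_symmPrime {p : ℕ} {k : Type} [Field k] (n : ℕ) {f : Fin p × Fin p → k}
    (hf : f ∈ symmPrime p k) : degProj p k n f ∈ symmPrime p k := by
  induction hf using Submodule.span_induction with
  | mem x hx =>
    obtain ⟨i, rfl⟩ := hx
    by_cases h : (i : ℕ) = n
    · rw [degProj_of_mem_degComp]
      · exact Submodule.subset_span ⟨i, rfl⟩
      · intro q hq
        simp only [Pi.add_apply, mono]
        rw [if_neg (by omega), if_neg (by omega), add_zero]
    · convert zero_mem (symmPrime p k)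
      funext q
      rw [degProj_apply]
      split_ifs with h'
      · simp only [Pi.add_apply, mono]
        rw [if_neg (by omega), if_neg (by omega), add_zero]
        rfl
      · rfl
  | zero => simp
  | add x y _ _ hx hy => rw [map_add]; exact add_mem hx hy
  | smul c x _ hx => rw [map_smul]; exact Submodule.smul_mem _ _ hx

lemma coeff_diff_pow (k : Type) [Field k] (n a b : ℕ) (h : a + b = n) :
    (sumDiffProd k 0 n).coeff (biExponent a b) = (-1) ^ b * (n.choose a : k) := by
  rw [sumDiffProd, pow_zero, one_mul, sub_eq_add_neg, add_pow, MvPolynomial.coeff_sum]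
  have e : ∀ m b : ℕ, MvPolynomial.X 0 ^ m * (-MvPolynomial.X 1) ^ b *
      ((n.choose m : ℕ) : MvPolynomial (Fin 2) k) =
      MvPolynomial.monomial (biExponent m b) ((-1) ^ b * (n.choose m : k)) := by
    intro m b
    rw [neg_pow, ← map_natCast (MvPolynomial.C : k →+* MvPolynomial (Fin 2) k),
      MvPolynomial.X_pow_eq_monomial, MvPolynomial.X_pow_eq_monomial,
      show (-1 : MvPolynomial (Fin 2) k) = MvPolynomial.C (-1) by simp, ← map_pow,
      MvPolynomial.C_mul_monomial, MvPolynomial.monomial_mul, mul_comm,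
      MvPolynomial.C_mul_monomial, biExponent]
    congr 1
    ring
  simp only [e, MvPolynomial.coeff_monomial, biExponent_inj]
  rw [Finset.sum_eq_single a]
  · rw [if_pos ⟨rfl, by omega⟩, show n - a = b by omega]
  · intro m _ hm
    rw [if_neg (by tauto)]
  · intro hm
    simp at hm
    omega

/-- Modulo `A_s'`, a homogeneous symmetric element killed by `e_{-1}` is a multiple of
`(x₁ - x₂)^i`. -/
lemma exists_sub_smul_mem_symmPrime {p : ℕ} {k : Type} [Field k] [CharP k p] {i : ℕ}
    (hi2 : 2 ≤ i) (hie : Even i) (hip : i < p) {f : Fin p × Fin p → k}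
    (hfs : f ∈ symmPart p k) (hfd : f ∈ degComp p k i)
    (hf : wittOp2 p k (-1) f ∈ symmPrime p k) :
    ∃ c : k, f - c • truncation p k (sumDiffProd k 0 i) ∈ symmPrime p k := by
  have hne : ∀ n : ℕ, 0 < n → n < p → (n : k) ≠ 0 := by
    intro n hn hnp h
    rw [CharP.cast_eq_zero_iff k p] at h
    exact absurd (Nat.le_of_dvd hn h) (by omega)
  set v := truncation p k (sumDiffProd k 0 i) with hv
  have hvq : ∀ q : Fin p × Fin p, (q.1 : ℕ) + q.2 = i →
      v q = (-1) ^ (q.2 : ℕ) * (i.choose q.1 : k) := fun q hq => by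
    rw [hv, truncation_apply, coeff_diff_pow k i _ _ hq]
  have hvd : v ∈ degComp p k i := by
    simpa using truncation_mem_degComp (p := p) (sumDiffProd_isHomogeneous k 0 i)
  have hvw : wittOp2 p k (-1) v = 0 := by
    have := wittOp2_truncation p k 0 (sumDiffProd k 0 i)
    rw [← hv] at this
    simp only [Nat.cast_zero, zero_sub] at this
    rw [this]
    simp [wittDerivation, sumDiffProd, Derivation.leibniz_pow, MvPolynomial.mkDerivation_X]
  have hq1 : v (⟨1, by omega⟩, ⟨i - 1, by omega⟩) ≠ 0 := by
    rw [hvq _ (by simp; omega)]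
    refine mul_ne_zero (pow_ne_zero _ (by simp)) ?_
    simpa using hne i (by omega) hip
  refine ⟨f (⟨1, by omega⟩, ⟨i - 1, by omega⟩) / v (⟨1, by omega⟩, ⟨i - 1, by omega⟩), ?_⟩
  set c := f (⟨1, by omega⟩, ⟨i - 1, by omega⟩) / v (⟨1, by omega⟩, ⟨i - 1, by omega⟩) with hc
  set g := f - c • v with hg
  have hgd : g ∈ degComp p k i := sub_mem hfd (Submodule.smul_mem _ _ hvd)
  have hgw : wittOp2 p k (((0 : ℕ) : ℤ) - 1) g ∈ symmPrime p k := by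
    simp only [Nat.cast_zero, zero_sub]
    rwa [hg, map_sub, map_smul, hvw, smul_zero, sub_zero]
  have hzero : ∀ a (h1 : a < p) (b : ℕ) (h2 : b < p), 1 ≤ a → 1 ≤ b → a + b = i →
      g (⟨a, h1⟩, ⟨b, h2⟩) = 0 := by
    intro a
    induction a with
    | zero => intro _ _ _ h; omega
    | succ a ih =>
      intro h1 b h2 _ hb hab
      rcases Nat.eq_zero_or_pos a with rfl | ha
      · obtain rfl : b = i - 1 := by omega
        simp only [hg, Pi.sub_apply, Pi.smul_apply, smul_eq_mul, zero_add, hc]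
        rw [div_mul_cancel₀ _ hq1, sub_self]
      · have h := apply_eq_zero_of_mem_symmPrime hgw (⟨a, by omega⟩, ⟨b, h2⟩)
          (by simp; omega) (by simp; omega)
        rw [wittOp2_apply] at h
        rw [dif_pos (by simp; omega), dif_pos (by simp; omega)] at h
        simp only [Nat.sub_zero] at h
        rw [ih (by omega) (b + 1) (by omega) ha (by omega) (by omega), mul_zero, add_zero] at h
        exact (mul_eq_zero.1 h).resolve_left (hne _ (by omega) (by omega))
  have hends : g (⟨0, by omega⟩, ⟨i, hip⟩) = g (⟨i, hip⟩, ⟨0, by omega⟩) := by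
    simp only [hg, Pi.sub_apply, Pi.smul_apply]
    rw [hvq _ (by simp), hvq _ (by simp), ← hfs]
    simp [hie.neg_one_pow]
  have : g = g (⟨i, hip⟩, ⟨0, by omega⟩) • (mono p k i 0 + mono p k 0 i) := by
    funext ⟨⟨a, ha⟩, ⟨b, hb⟩⟩
    simp only [Pi.smul_apply, Pi.add_apply, mono, smul_eq_mul]
    by_cases hab : a + b = i
    · rcases Nat.eq_zero_or_pos a with rfl | ha'
      · obtain rfl : b = i := by omega
        rw [if_neg (by omega), if_pos ⟨rfl, rfl⟩, hends]
        ring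
      · rcases Nat.eq_zero_or_pos b with rfl | hb'
        · obtain rfl : a = i := by omega
          rw [if_pos ⟨rfl, rfl⟩, if_neg (by omega)]
          ring
        · rw [hzero a ha b hb ha' hb' hab, if_neg (by omega), if_neg (by omega)]
          ring
    · rw [hgd _ hab, if_neg (by omega), if_neg (by omega)]
      ring
  rw [this]
  exact Submodule.smul_mem _ _ (Submodule.subset_span ⟨⟨i, hip⟩, rfl⟩)

lemma linearIndependent_sumDiffProd {k : Type} [Field k] (h2 : (2 : k) ≠ 0) (i l : ℕ) :
    LinearIndependent k
      (fun m : Fin (l / 2 + 1) => sumDiffProd k (l - 2 * m) (i + 2 * m)) := by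
  rw [Fintype.linearIndependent_iff]
  intro c hc m
  have h := congrArg (MvPolynomial.aeval (R := k)
    ![(Polynomial.C (2⁻¹ : k) * (1 + Polynomial.X) : Polynomial k),
      Polynomial.C (2⁻¹ : k) * (1 - Polynomial.X)]) hc
  have hhalf : (Polynomial.C (2⁻¹ : k)) * 2 = 1 := by
    rw [← map_ofNat (Polynomial.C : k →+* Polynomial k) 2, ← map_mul, inv_mul_cancel₀ h2, map_one]
  have e1 : Polynomial.C (2⁻¹ : k) * (1 + Polynomial.X) +
      Polynomial.C (2⁻¹ : k) * (1 - Polynomial.X) = 1 := by linear_combination hhalf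
  have e2 : Polynomial.C (2⁻¹ : k) * (1 + Polynomial.X) -
      Polynomial.C (2⁻¹ : k) * (1 - Polynomial.X) = Polynomial.X := by
    linear_combination Polynomial.X * hhalf
  simp only [map_sum, map_smul, sumDiffProd, map_mul, map_pow, map_add, map_sub,
    MvPolynomial.aeval_X, Matrix.cons_val_zero, Matrix.cons_val_one, e1, e2, one_pow, one_mul,
    map_zero] at h
  have h' := congrArg (fun P : Polynomial k => P.coeff (i + 2 * m)) h
  simp only [Polynomial.finsetSum_coeff, Polynomial.coeff_smul, Polynomial.coeff_X_pow,
    Polynomial.coeff_zero] at h'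
  rw [Finset.sum_eq_single m] at h'
  · simpa using h'
  · intro b _ hb
    rw [if_neg, smul_zero]
    intro hh
    apply hb
    ext
    omega
  · simp

lemma eq_zero_of_truncation_mem_symmPrime {p : ℕ} {k : Type} [Field k] (h2 : (2 : k) ≠ 0)
    {n : ℕ} (hn0 : 0 < n) (hn : n ≤ p) {F : MvPolynomial (Fin 2) k} (hF : F.IsHomogeneous n)
    (hsymm : F.eval ![1, 0] = F.eval ![0, 1]) (hdiag : F.eval ![1, 1] = 0)
    (hmem : truncation p k F ∈ symmPrime p k) : F = 0 := by
  obtain ⟨α, β, rfl⟩ : ∃ α β : k, F = MvPolynomial.C α * MvPolynomial.X 0 ^ n +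
      MvPolynomial.C β * MvPolynomial.X 1 ^ n := by
    refine ⟨F.coeff (biExponent n 0), F.coeff (biExponent 0 n), ?_⟩
    ext m
    obtain ⟨a, b, rfl⟩ : ∃ a b, m = biExponent a b := ⟨_, _, (biExponent_eta m).symm⟩
    have e0 : Finsupp.single (0 : Fin 2) n = biExponent n 0 := by simp [biExponent]
    have e1 : Finsupp.single (1 : Fin 2) n = biExponent 0 n := by simp [biExponent]
    rw [MvPolynomial.X_pow_eq_monomial, MvPolynomial.X_pow_eq_monomial, e0, e1]
    simp only [MvPolynomial.coeff_add, MvPolynomial.coeff_C_mul, MvPolynomial.coeff_monomial,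
      biExponent_inj]
    by_cases hab : a + b = n
    · rcases Nat.eq_zero_or_pos a with rfl | ha
      · obtain rfl : b = n := by omega
        rw [if_neg (by omega), if_pos ⟨rfl, rfl⟩]
        ring
      · rcases Nat.eq_zero_or_pos b with rfl | hb
        · obtain rfl : a = n := by omega
          rw [if_neg (by omega : ¬ (0 = a ∧ a = 0)), if_pos ⟨rfl, rfl⟩]
          ring
        · rw [if_neg (by omega), if_neg (by omega)]
          have := apply_eq_zero_of_mem_symmPrime hmem (⟨a, by omega⟩, ⟨b, by omega⟩)
            (by simp; omega) (by simp; omega)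
          rw [truncation_apply] at this
          simpa using this
    · rw [if_neg (by omega), if_neg (by omega), hF.coeff_eq_zero]
      · ring
      · simpa [biExponent, map_add] using hab
  simp only [map_add, map_mul, MvPolynomial.eval_C, map_pow, MvPolynomial.eval_X,
    Matrix.cons_val_zero, Matrix.cons_val_one, one_pow, zero_pow hn0.ne', mul_one, mul_zero,
    add_zero, zero_add] at hsymm hdiag
  subst hsymm
  have : α = 0 := by
    rw [← two_mul] at hdiag
    exact (mul_eq_zero.1 hdiag).resolve_left h2
  simp [this]

lemma linearIndependent_mkQ_sumDiffProd {p : ℕ} {k : Type} [Field k] (h2 : (2 : k) ≠ 0)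
    {i l : ℕ} (hi2 : 2 ≤ i) (hie : Even i) (hl : i + l ≤ p) :
    LinearIndependent k (fun m : Fin (l / 2 + 1) =>
      (symmPrime p k).mkQ (truncation p k (sumDiffProd k (l - 2 * m) (i + 2 * m)))) := by
  rw [Fintype.linearIndependent_iff]
  intro c hc
  refine Fintype.linearIndependent_iff.1 (linearIndependent_sumDiffProd h2 i l) c ?_
  refine eq_zero_of_truncation_mem_symmPrime (p := p) h2 (n := i + l) (by omega) hl ?_ ?_ ?_ ?_
  · refine MvPolynomial.IsHomogeneous.sum _ _ _ fun m _ => ?_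
    have := sumDiffProd_isHomogeneous k (l - 2 * m) (i + 2 * m)
    rw [show l - 2 * (m : ℕ) + (i + 2 * m) = i + l by omega] at this
    exact (MvPolynomial.homogeneousSubmodule (Fin 2) k (i + l)).smul_mem _ this
  · simp only [map_sum, MvPolynomial.smul_eval, sumDiffProd, map_mul, map_pow, map_add, map_sub,
      MvPolynomial.eval_X, Matrix.cons_val_zero, Matrix.cons_val_one]
    refine Finset.sum_congr rfl fun m _ => ?_
    have : Even (i + 2 * (m : ℕ)) := hie.add (even_two_mul _)
    rw [zero_sub, this.neg_one_pow]
    simp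
  · simp only [map_sum, MvPolynomial.smul_eval, sumDiffProd, map_mul, map_pow, map_add, map_sub,
      MvPolynomial.eval_X, Matrix.cons_val_zero, Matrix.cons_val_one]
    refine Finset.sum_eq_zero fun m _ => ?_
    rw [sub_self, zero_pow (by omega), mul_zero, mul_zero]
  · rw [← Submodule.Quotient.mk_eq_zero, ← Submodule.mkQ_apply]
    simpa only [map_sum, map_smul] using hc

/-- let `w` be a nonzero element of `(A_s⁺)_i ∩ ker e_{-1}` for even `i`
with `2 ≤ i ≤ p-1` (realizing `A_s⁺` as the image of `A_s` in `Q = A_{(2)}/A_s'`).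
If `l + i ≤ p`, then the degree-`(i+l)` graded component of the `W(1)`-submodule of
`A_s⁺` generated by `w` has dimension `⌊l/2⌋ + 1`. -/
theorem graded_component_dim_of_cyclic_submodule (p : ℕ) (k : Type) [Field k] [IsAlgClosed k]
    [CharP k p] (hp : p.Prime) (hp3 : 3 < p)
    (hstab : ∀ j : ℤ, symmPrime p k ≤ (symmPrime p k).comap (wittOp2 p k j))
    (i : ℕ) (hi2 : 2 ≤ i) (hie : Even i) (hip : i ≤ p - 1)
    (w : (Fin p × Fin p → k) ⧸ symmPrime p k)
    (hw : w ∈ Submodule.map (symmPrime p k).mkQ (symmPart p k ⊓ degComp p k i))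
    (hw0 : w ≠ 0)
    (hwker : Submodule.mapQ (symmPrime p k) (symmPrime p k) (wittOp2 p k (-1))
      (hstab (-1)) w = 0) :
    ∀ l : ℕ, l + i ≤ p →
      Module.finrank k
        ↥(sInf {N : Submodule k ((Fin p × Fin p → k) ⧸ symmPrime p k) |
            w ∈ N ∧ ∀ j : ℤ, -1 ≤ j → j ≤ (p : ℤ) - 2 → ∀ u ∈ N,
              Submodule.mapQ (symmPrime p k) (symmPrime p k) (wittOp2 p k j) (hstab j) u ∈ N} ⊓
          Submodule.map (symmPrime p k).mkQ (degComp p k (i + l))) =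
        l / 2 + 1 := by
  intro l hl
  have hne : ∀ n : ℕ, 0 < n → n < p → (n : k) ≠ 0 := by
    intro n hn hnp h
    rw [CharP.cast_eq_zero_iff k p] at h
    exact absurd (Nat.le_of_dvd hn h) (by omega)
  have h2k : (2 : k) ≠ 0 := by exact_mod_cast hne 2 (by omega) (by omega)
  set Ψ : MvPolynomial (Fin 2) k →ₗ[k] (Fin p × Fin p → k) ⧸ symmPrime p k :=
    (symmPrime p k).mkQ ∘ₗ truncation p k with hΨ
  have hact : ∀ (t : ℕ) (j : ℤ), j = t - 1 → ∀ f, Submodule.mapQ (symmPrime p k) (symmPrime p k)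
      (wittOp2 p k j) (hstab j) (Ψ f) = Ψ (wittDerivation k t f) := by
    rintro t j rfl f
    simp only [hΨ, LinearMap.comp_apply, Submodule.mkQ_apply, Submodule.mapQ_apply]
    rw [wittOp2_truncation]
  obtain ⟨c, hc0, hwc⟩ : ∃ c : k, c ≠ 0 ∧ w = c • Ψ (sumDiffProd k 0 i) := by
    obtain ⟨f, ⟨hfs, hfd⟩, rfl⟩ := hw
    rw [Submodule.mkQ_apply, Submodule.mapQ_apply, Submodule.Quotient.mk_eq_zero] at hwker
    obtain ⟨c, hc⟩ := exists_sub_smul_mem_symmPrime hi2 hie (by omega) hfs hfd hwker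
    have hwc : (symmPrime p k).mkQ f = c • Ψ (sumDiffProd k 0 i) := by
      rw [hΨ, LinearMap.comp_apply, ← map_smul]
      exact (Submodule.Quotient.eq _).2 hc
    refine ⟨c, ?_, hwc⟩
    rintro rfl
    exact hw0 (by rw [hwc, zero_smul])
  set N := sInf {N : Submodule k ((Fin p × Fin p → k) ⧸ symmPrime p k) |
    w ∈ N ∧ ∀ j : ℤ, -1 ≤ j → j ≤ (p : ℤ) - 2 → ∀ u ∈ N,
      Submodule.mapQ (symmPrime p k) (symmPrime p k) (wittOp2 p k j) (hstab j) u ∈ N} with hN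
  have hwN : w ∈ N := Submodule.mem_sInf.2 fun M hM => hM.1
  have hNstab : ∀ j : ℤ, -1 ≤ j → j ≤ (p : ℤ) - 2 → ∀ u ∈ N,
      Submodule.mapQ (symmPrime p k) (symmPrime p k) (wittOp2 p k j) (hstab j) u ∈ N :=
    fun j h1 h2 u hu => Submodule.mem_sInf.2 fun M hM =>
      hM.2 j h1 h2 u (Submodule.mem_sInf.1 hu M hM)
  have hNle : N ≤ (sumDiffSpan k i).map Ψ := by
    refine sInf_le ⟨?_, ?_⟩
    · rw [hwc]
      exact Submodule.smul_mem _ _ ⟨_, sumDiffProd_mem_span k 0 i 0, rfl⟩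
    · rintro j h1 - _ ⟨f, hf, rfl⟩
      rw [hact (j + 1).toNat j (by omega)]
      exact ⟨_, wittDerivation_mem_sumDiffSpan h2k _ _ hf, rfl⟩
  have hspan : N ⊓ Submodule.map (symmPrime p k).mkQ (degComp p k (i + l)) =
      Submodule.span k (Set.range fun m : Fin (l / 2 + 1) =>
        Ψ (sumDiffProd k (l - 2 * m) (i + 2 * m))) := by
    apply le_antisymm
    · rintro u ⟨huN, g, hg, hgu⟩
      obtain ⟨f, hf, hfu⟩ := hNle huN
      have hdiff : truncation p k f - g ∈ symmPrime p k := by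
        refine (Submodule.Quotient.eq _).1 ?_
        exact hfu.trans hgu.symm
      have h := degProj_mem_symmPrime (i + l) hdiff
      rw [map_sub, degProj_truncation, degProj_of_mem_degComp hg] at h
      have hu : u = Ψ (MvPolynomial.homogeneousComponent (i + l) f) := by
        rw [← hgu]
        exact ((Submodule.Quotient.eq _).2 h).symm
      rw [hu, Set.range_comp' Ψ, ← Submodule.map_span]
      exact ⟨_, homogeneousComponent_mem_of_mem_sumDiffSpan i l hf, rfl⟩
    · refine Submodule.span_le.2 ?_
      rintro _ ⟨m, rfl⟩
      refine ⟨?_, _, ?_, rfl⟩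
      · refine sumDiffProd_mem_of_stable (p := p) hi2 (N.comap Ψ) ?_ ?_ ?_ l (by omega) _ _
          (by omega)
        · rw [hwc] at hwN
          exact (N.smul_mem_iff hc0).1 hwN
        · intro f hf
          rw [Submodule.mem_comap, ← hact 2 1 (by norm_num)]
          exact hNstab 1 (by omega) (by omega) _ hf
        · intro f hf
          rw [Submodule.mem_comap, ← hact 3 2 (by norm_num)]
          exact hNstab 2 (by omega) (by omega) _ hf
      · have := truncation_mem_degComp (p := p)
          (sumDiffProd_isHomogeneous k (l - 2 * m) (i + 2 * m))
        rwa [show l - 2 * (m : ℕ) + (i + 2 * m) = i + l by omega] at this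
  rw [hspan, finrank_span_eq_card]
  · simp
  · exact linearIndependent_mkQ_sumDiffProd h2k hi2 hie (by omega)
end

section
/- In the Grothendieck group of finite-dimensional restricted W(1)-modules, the class of L(p−1) ⊗ L(p−1) equals the sum of the classes [L(0)] + [L(1)] + ... + [L(p−2)], where L(λ) are the simple restricted W(1)-modules (L(λ) = Z(λ) for 1 ≤ λ ≤ p−2, L(0) is trivial, L(p−1) = Z(p−1)/k is (p−1)-dimensional). -/
set_option synthInstance.maxHeartbeats 1000000
set_option maxHeartbeats 1000000

open TensorProduct

/-- The action of the Witt-algebra basis element `e_κ` (`-1 ≤ κ ≤ p-2`) on the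
`p`-dimensional Verma-type module `Z(λ)` with basis `m_0, …, m_{p-1}`:
`e_κ · m_j = (j + κ + 1 + (κ+1)λ) m_{j+κ}`, with `m_i = 0` for `i < 0` or `i > p-1`.
For `1 ≤ λ ≤ p-2` this is the simple restricted module `L(λ)`. -/
noncomputable def vermaOp (p : ℕ) (k : Type) [Field k] (lam κ : ℤ) :
    (Fin p → k) →ₗ[k] (Fin p → k) :=
  Matrix.toLin' (Matrix.of fun n j : Fin p =>
    if (j : ℤ) = (n : ℤ) - κ then (((n : ℤ) + 1 + (κ + 1) * lam : ℤ) : k) else 0)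

/-- The action of the Witt-algebra basis element `e_κ` on the `(p-1)`-dimensional
simple module `L(p-1) = Z(p-1)/k·m_0`, with basis (the classes of) `m_1, …, m_{p-1}`:
the index `s : Fin (p-1)` stands for `m_{s+1}`, and
`e_κ · m_j = (j + κ + 1 + (κ+1)(p-1)) m_{j+κ}` (with `m_0 = 0` in the quotient and
`m_i = 0` for `i > p-1`). -/
noncomputable def topSimpleOp (p : ℕ) (k : Type) [Field k] (κ : ℤ) :
    (Fin (p - 1) → k) →ₗ[k] (Fin (p - 1) → k) :=
  Matrix.toLin' (Matrix.of fun s t : Fin (p - 1) =>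
    if (t : ℤ) = (s : ℤ) - κ then
      (((s : ℤ) + 2 + (κ + 1) * ((p : ℤ) - 1) : ℤ) : k) else 0)

/-- The diagonal action of `e_κ` on the tensor square `L(p-1) ⊗ L(p-1)`. -/
noncomputable def tensorOp (p : ℕ) (k : Type) [Field k] (κ : ℤ) :
    ((Fin (p - 1) → k) ⊗[k] (Fin (p - 1) → k)) →ₗ[k]
      ((Fin (p - 1) → k) ⊗[k] (Fin (p - 1) → k)) :=
  LinearMap.rTensor _ (topSimpleOp p k κ) + LinearMap.lTensor _ (topSimpleOp p k κ)

namespace WittTensor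

variable (p : ℕ) (k : Type) [Field k]

/-- The class of `x ^ a` in `L(p-1)`, which is zero unless `1 ≤ a ≤ p - 1`. -/
def monomialClass (a : ℕ) : Fin (p - 1) → k := fun s => if (s : ℕ) + 1 = a then 1 else 0

/-- The `n`-th coordinate of the `q`-th transverse derivative along the diagonal: it sends
`x ^ a ⊗ x ^ b` to `b * a.choose q` if `a + b - 1 - q = n`, and to `0` otherwise. -/
noncomputable def transverseCoeff (q : ℕ) (n : ℤ) :
    ((Fin (p - 1) → k) ⊗[k] (Fin (p - 1) → k)) →ₗ[k] k :=
  ∑ s : Fin (p - 1), ∑ t : Fin (p - 1),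
    (if (s : ℤ) + t + 1 - q = n then ((t : ℕ) + 1 : k) * ((s : ℕ) + 1).choose q else 0) •
      ((Pi.basisFun k (Fin (p - 1))).tensorProduct (Pi.basisFun k (Fin (p - 1)))).coord (s, t)

variable {p k}

lemma single_eq_monomialClass (s : Fin (p - 1)) :
    (Pi.single s 1 : Fin (p - 1) → k) = monomialClass p k (s + 1) := by
  ext t
  simp [monomialClass, Pi.single_apply, Fin.ext_iff]

lemma monomialClass_of_le {a : ℕ} (ha : p ≤ a) : monomialClass p k a = 0 := by
  ext s
  have := s.2
  simp only [monomialClass, Pi.zero_apply, ite_eq_right_iff]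
  omega

lemma monomialClass_zero : monomialClass p k 0 = 0 := by
  ext s
  simp [monomialClass]

lemma transverseCoeff_single (q : ℕ) (n : ℤ) (s t : Fin (p - 1)) :
    transverseCoeff p k q n (Pi.single s 1 ⊗ₜ Pi.single t 1) =
      if (s : ℤ) + t + 1 - q = n then ((t : ℕ) + 1 : k) * ((s : ℕ) + 1).choose q else 0 := by
  simp only [transverseCoeff, LinearMap.sum_apply, LinearMap.smul_apply, Module.Basis.coord_apply,
    Module.Basis.tensorProduct_repr_tmul_apply, Pi.basisFun_repr, smul_eq_mul]
  rw [Finset.sum_eq_single s, Finset.sum_eq_single t]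
  · simp
  · intro b _ hb
    simp [hb]
  · simp
  · intro b _ hb
    simp [hb]
  · simp

lemma transverseCoeff_monomialClass [CharP k p] (hp : p.Prime) {q : ℕ} (hq : 1 ≤ q) (hqp : q < p)
    {n : ℤ} (hn : n < p) (a b : ℕ) :
    transverseCoeff p k q n (monomialClass p k a ⊗ₜ monomialClass p k b) =
      if (a : ℤ) + b - 1 - q = n then (b : k) * a.choose q else 0 := by
  by_cases hab : a = 0 ∨ b = 0 ∨ p ≤ a ∨ p ≤ b
  · have h0 : monomialClass p k a ⊗ₜ[k] monomialClass p k b = 0 := by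
      rcases hab with rfl | rfl | h | h
      · rw [monomialClass_zero, TensorProduct.zero_tmul]
      · rw [monomialClass_zero, TensorProduct.tmul_zero]
      · rw [monomialClass_of_le h, TensorProduct.zero_tmul]
      · rw [monomialClass_of_le h, TensorProduct.tmul_zero]
    rw [h0, map_zero, eq_comm, ite_eq_right_iff]
    intro h
    rcases Nat.lt_or_ge a q with haq | haq
    · simp [Nat.choose_eq_zero_of_lt haq]
    rcases Nat.eq_zero_or_pos b with rfl | hb
    · simp
    rcases Nat.lt_or_ge a p with hap | hap
    · have : b = p := by omega
      simp [this]
    · have : p ∣ a.choose q := hp.dvd_choose hqp (by omega) hap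
      rw [(CharP.cast_eq_zero_iff k p _).2 this, mul_zero]
  · push Not at hab
    obtain ⟨ha, hb, hap, hbp⟩ := hab
    obtain ⟨a, rfl⟩ := Nat.exists_eq_succ_of_ne_zero ha
    obtain ⟨b, rfl⟩ := Nat.exists_eq_succ_of_ne_zero hb
    have h := transverseCoeff_single (k := k) q n
      (⟨a, by omega⟩ : Fin (p - 1)) (⟨b, by omega⟩ : Fin (p - 1))
    rw [single_eq_monomialClass, single_eq_monomialClass] at h
    simp only [Nat.succ_eq_add_one]
    rw [h]
    have : ((a : ℤ) + b + 1 - q = n) ↔ (((a + 1 : ℕ) : ℤ) + (b + 1 : ℕ) - 1 - q = n) := by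
      push_cast
      constructor <;> intro h <;> linarith
    simp only [this]
    push_cast
    rfl

lemma transverseCoeff_of_neg (q : ℕ) {n : ℤ} (hn : n < 0) : transverseCoeff p k q n = 0 := by
  refine Finset.sum_eq_zero fun s _ => Finset.sum_eq_zero fun t _ => ?_
  split_ifs with h
  · rw [Nat.choose_eq_zero_of_lt (by omega)]
    simp
  · simp

lemma transverseCoeff_top : transverseCoeff p k (p - 1) ((p : ℤ) - 1) = 0 := by
  refine Finset.sum_eq_zero fun s _ => Finset.sum_eq_zero fun t _ => ?_
  rw [if_neg (by omega), zero_smul]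

lemma topSimpleOp_monomialClass [CharP k p] (c a : ℕ) (ha : a < p - 1) :
    topSimpleOp p k ((c : ℤ) - 1) (monomialClass p k (a + 1)) =
      ((a + 1 : ℕ) : k) • monomialClass p k (a + c) := by
  have hs := single_eq_monomialClass (k := k) (⟨a, ha⟩ : Fin (p - 1))
  simp only at hs
  rw [← hs]
  ext s
  simp only [topSimpleOp, Matrix.toLin'_apply, Matrix.mulVec_single_one, Matrix.col_apply,
    Matrix.of_apply, Pi.smul_apply, monomialClass, smul_eq_mul, mul_ite, mul_one, mul_zero]
  have : ((a : ℤ) = (s : ℤ) - (c - 1)) ↔ ((s : ℕ) + 1 = a + c) := by omega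
  simp only [this]
  split_ifs with h
  · have : ((s : ℕ) : k) + 1 = a + c := by exact_mod_cast congrArg (Nat.cast : ℕ → k) h
    push_cast
    rw [CharP.cast_eq_zero k p]
    linear_combination this
  · rfl

lemma mul_choose_add_sub_one (a c q : ℕ) (hq : 1 ≤ q) :
    ((a : ℤ) + 1) * ((a + c).choose q : ℤ) =
      ((a : ℤ) + 1 - q + c * q) * ((a + 1).choose q : ℤ) +
        ∑ l ∈ Finset.range (q - 1), (c.choose (l + 2) : ℤ) * ((q - 1 - l : ℕ) : ℤ) *
          ((a + 1).choose (q - 1 - l) : ℤ) := by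
  have key (r : ℕ) : ((a : ℤ) + 1) * (a.choose r : ℤ) = (r + 1) * ((a + 1).choose (r + 1) : ℤ) := by
    have := Nat.add_one_mul_choose_eq a r
    zify at this
    linarith
  obtain ⟨q, rfl⟩ := Nat.exists_eq_add_of_le' hq
  have h0 : ((q : ℤ) + 2) * ((a + 1).choose (q + 2) : ℤ) =
      ((a : ℤ) - q) * ((a + 1).choose (q + 1) : ℤ) := by
    have h := Nat.choose_succ_right_eq (a + 1) (q + 1)
    rcases Nat.lt_or_ge (a + 1) (q + 1) with hlt | hge
    · rw [Nat.choose_eq_zero_of_lt hlt, Nat.choose_eq_zero_of_lt (by omega)]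
      simp
    · zify [hge] at h
      linear_combination h
  rw [Nat.add_comm a c, Nat.add_choose_eq, Finset.Nat.sum_antidiagonal_eq_sum_range_succ_mk,
    Finset.sum_range_succ', Finset.sum_range_succ']
  push_cast
  rw [mul_add, mul_add, Finset.mul_sum]
  have hs : ∀ l ∈ Finset.range q, ((a : ℤ) + 1) *
      ((c.choose (l + 1 + 1) : ℤ) * (a.choose (q - (l + 1)) : ℤ)) =
      (c.choose (l + 2) : ℤ) * ((q - l : ℕ) : ℤ) * ((a + 1).choose (q - l) : ℤ) := by
    intro l hl
    have hl := Finset.mem_range.1 hl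
    obtain ⟨r, rfl⟩ := Nat.exists_eq_add_of_lt hl
    rw [show l + r + 1 - (l + 1) = r by omega, show l + r + 1 - l = r + 1 by omega]
    push_cast
    linear_combination (c.choose (l + 2) : ℤ) * key r
  rw [Finset.sum_congr rfl hs]
  have k1 := key q
  have k2 := key (q + 1)
  simp only [Nat.choose_zero_right, Nat.choose_one_right]
  push_cast at k2 ⊢
  linear_combination (c : ℤ) * k1 + k2 + h0

/-- The `q`-th transverse derivative intertwines the tensor square with `Z(q)` up to lower ones. -/
lemma transverseCoeff_tensorOp [CharP k p] (hp : p.Prime) {q : ℕ} (hq : 1 ≤ q) (hqp : q < p)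
    {n : ℤ} (hn : n < p) (c : ℕ) (w : (Fin (p - 1) → k) ⊗[k] (Fin (p - 1) → k)) :
    transverseCoeff p k q n (tensorOp p k ((c : ℤ) - 1) w) =
      ((n + 1 + c * q : ℤ) : k) * transverseCoeff p k q (n + 1 - c) w +
        ∑ l ∈ Finset.range (q - 1), (c.choose (l + 2) : k) * ((q - 1 - l : ℕ) : k) *
          transverseCoeff p k (q - 1 - l) (n + 2 + l - c) w := by
  suffices h : transverseCoeff p k q n ∘ₗ tensorOp p k ((c : ℤ) - 1) =
      ((n + 1 + c * q : ℤ) : k) • transverseCoeff p k q (n + 1 - c) +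
        ∑ l ∈ Finset.range (q - 1), ((c.choose (l + 2) : k) * ((q - 1 - l : ℕ) : k)) •
          transverseCoeff p k (q - 1 - l) (n + 2 + l - c) by
    simpa using LinearMap.congr_fun h w
  refine ((Pi.basisFun k (Fin (p - 1))).tensorProduct (Pi.basisFun k (Fin (p - 1)))).ext ?_
  rintro ⟨s, t⟩
  simp only [Module.Basis.tensorProduct_apply, Pi.basisFun_apply, LinearMap.comp_apply,
    LinearMap.add_apply, LinearMap.smul_apply, LinearMap.sum_apply, transverseCoeff_single]
  rw [single_eq_monomialClass, single_eq_monomialClass, tensorOp, LinearMap.add_apply,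
    LinearMap.rTensor_tmul, LinearMap.lTensor_tmul, topSimpleOp_monomialClass _ _ s.2,
    topSimpleOp_monomialClass _ _ t.2, map_add, ← TensorProduct.smul_tmul', TensorProduct.tmul_smul,
    map_smul, map_smul, transverseCoeff_monomialClass hp hq hqp hn,
    transverseCoeff_monomialClass hp hq hqp hn]
  by_cases h : (s : ℤ) + t + c - q = n
  · rw [if_pos (by push_cast; linarith), if_pos (by push_cast; linarith),
      if_pos (by linarith)]
    have hsum : ∀ l ∈ Finset.range (q - 1), ((c.choose (l + 2) : k) * ((q - 1 - l : ℕ) : k)) •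
        (if (s : ℤ) + t + 1 - (q - 1 - l : ℕ) = n + 2 + l - c then
          ((t : ℕ) + 1 : k) * (((s : ℕ) + 1).choose (q - 1 - l) : k) else 0) =
        ((t : ℕ) + 1 : k) * ((c.choose (l + 2) : k) * ((q - 1 - l : ℕ) : k) *
          (((s : ℕ) + 1).choose (q - 1 - l) : k)) := by
      intro l hl
      have hl := Finset.mem_range.1 hl
      rw [if_pos (by omega), smul_eq_mul]
      ring
    rw [Finset.sum_congr rfl hsum, ← Finset.mul_sum]
    have key := congrArg (Int.cast : ℤ → k) (mul_choose_add_sub_one (s : ℕ) c q hq)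
    push_cast at key
    subst h
    push_cast
    simp only [smul_eq_mul]
    linear_combination ((t : ℕ) + 1 : k) * key
  · rw [if_neg (by push_cast; intro h'; exact h (by linarith)),
      if_neg (by push_cast; intro h'; exact h (by linarith)), if_neg (by omega)]
    rw [Finset.sum_eq_zero]
    · simp
    · intro l hl
      have hl := Finset.mem_range.1 hl
      rw [if_neg (by omega), smul_zero]

/-- A multiple of `(x - y) ^ (q - 1) dx dy`, seen in `L(p-1) ⊗ L(p-1)` through the embedding
`f ⊗ g ↦ df ⊗ dg`. -/
noncomputable def diagonalPower (p : ℕ) (k : Type) [Field k] (q : ℕ) :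
    (Fin (p - 1) → k) ⊗[k] (Fin (p - 1) → k) :=
  ∑ j ∈ Finset.range q, ((-1) ^ (q - 1 - j) * ((q - 1).choose j : k) *
    (((j + 1 : ℕ) : k) * ((q - j : ℕ) : k))⁻¹) •
      (monomialClass p k (j + 1) ⊗ₜ monomialClass p k (q - j))

lemma natCast_ne_zero_of_lt [CharP k p] {a : ℕ} (ha : 0 < a) (hap : a < p) : (a : k) ≠ 0 := by
  rw [Ne, CharP.cast_eq_zero_iff k p]
  exact Nat.not_dvd_of_pos_of_lt ha hap

lemma sum_neg_one_pow_mul_choose_mul_choose (i r : ℕ) :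
    ∑ j ∈ Finset.range (i + 1), (-1 : ℤ) ^ (i - j) * (i.choose j : ℤ) * (j.choose r : ℤ) =
      if i = r then 1 else 0 := by
  have h := fwdDiff_iter_choose_zero r i
  rw [fwdDiff_iter_eq_sum_shift] at h
  simpa using h

lemma transverseCoeff_diagonalPower [CharP k p] (hp : p.Prime) {q r : ℕ} (hqp : q < p)
    (hr : 1 ≤ r) (hrq : r ≤ q) {n : ℤ} (hn : n < p) :
    transverseCoeff p k r n (diagonalPower p k q) =
      if q = r ∧ n = 0 then (q : k)⁻¹ else 0 := by
  have hr0 : (r : k) ≠ 0 := natCast_ne_zero_of_lt (p := p) hr (by omega)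
  have hterm : ∀ j ∈ Finset.range q, transverseCoeff p k r n
      (((-1) ^ (q - 1 - j) * ((q - 1).choose j : k) *
        (((j + 1 : ℕ) : k) * ((q - j : ℕ) : k))⁻¹) •
          (monomialClass p k (j + 1) ⊗ₜ monomialClass p k (q - j))) =
      (if (q : ℤ) - r = n then (r : k)⁻¹ else 0) *
        (((-1 : ℤ) ^ (q - 1 - j) * ((q - 1).choose j : ℤ) * (j.choose (r - 1) : ℤ) : ℤ) : k) := by
    intro j hj
    have hj := Finset.mem_range.1 hj
    have hj1 : ((j + 1 : ℕ) : k) ≠ 0 := natCast_ne_zero_of_lt (p := p) (by omega) (by omega)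
    have hj2 : ((q - j : ℕ) : k) ≠ 0 := natCast_ne_zero_of_lt (p := p) (by omega) (by omega)
    rw [map_smul, transverseCoeff_monomialClass hp hr (by omega) hn]
    have hiff : (((j + 1 : ℕ) : ℤ) + ((q - j : ℕ) : ℤ) - 1 - r = n) ↔ (q : ℤ) - r = n := by
      omega
    simp only [hiff]
    split_ifs
    · obtain ⟨r, rfl⟩ := Nat.exists_eq_add_of_le' hr
      have h := congrArg (Nat.cast : ℕ → k) (Nat.add_one_mul_choose_eq j r)
      push_cast at h hj1 hr0 ⊢
      simp only [smul_eq_mul]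
      field_simp
      linear_combination (-((q - 1).choose j : k)) * h
    · simp
  rw [diagonalPower, map_sum, Finset.sum_congr rfl hterm, ← Finset.mul_sum, ← Int.cast_sum]
  have hsum := sum_neg_one_pow_mul_choose_mul_choose (q - 1) (r - 1)
  rw [Nat.sub_add_cancel (by omega)] at hsum
  rw [hsum]
  by_cases h : q = r
  · subst h
    simp [eq_comm]
  · rw [if_neg (show ¬ q - 1 = r - 1 by omega), if_neg (show ¬ (q = r ∧ n = 0) by tauto),
      Int.cast_zero, mul_zero]

/-- The descending filtration by order of vanishing along the diagonal, indexed so that it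
increases from `0` at `t = 0` to the whole tensor square at `t = p - 1`. -/
def diagonalFiltration (p : ℕ) (k : Type) [Field k] (t : ℕ) :
    Submodule k ((Fin (p - 1) → k) ⊗[k] (Fin (p - 1) → k)) where
  carrier := {w | ∀ q, 1 ≤ q → q + t < p → ∀ n : ℤ, n < p → transverseCoeff p k q n w = 0}
  add_mem' := fun {v w} hv hw q hq hqt n hn => by
    rw [map_add, hv q hq hqt n hn, hw q hq hqt n hn, add_zero]
  zero_mem' := fun q _ _ n _ => map_zero _
  smul_mem' := fun c w hw q hq hqt n hn => by
    rw [map_smul, hw q hq hqt n hn, smul_zero]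

lemma mem_diagonalFiltration {t : ℕ} {w : (Fin (p - 1) → k) ⊗[k] (Fin (p - 1) → k)} :
    w ∈ diagonalFiltration p k t ↔
      ∀ q, 1 ≤ q → q + t < p → ∀ n : ℤ, n < p → transverseCoeff p k q n w = 0 :=
  Iff.rfl

lemma diagonalFiltration_mono : Monotone (diagonalFiltration p k) :=
  fun _ _ hst _ hw q hq hqt n hn => hw q hq (by omega) n hn

lemma diagonalFiltration_eq_top : diagonalFiltration p k (p - 1) = ⊤ := by
  rw [eq_top_iff]
  intro w _ q hq hqt
  omega

lemma diagonalFiltration_zero [CharP k p] : diagonalFiltration p k 0 = ⊥ := by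
  rw [eq_bot_iff]
  intro w hw
  rw [Submodule.mem_bot]
  set B := (Pi.basisFun k (Fin (p - 1))).tensorProduct (Pi.basisFun k (Fin (p - 1))) with hB
  have main (d : ℕ) : ∀ s t : Fin (p - 1), (s : ℕ) + d + 2 = p → B.coord (s, t) w = 0 := by
    induction d using Nat.strong_induction_on with
    | _ d ih =>
      intro s t hs
      have h := hw (s + 1) (by omega) (by omega) (t : ℤ) (by omega)
      rw [transverseCoeff, LinearMap.sum_apply, Finset.sum_eq_single s, LinearMap.sum_apply,
        Finset.sum_eq_single t] at h
      · rw [if_pos (by push_cast; ring), LinearMap.smul_apply, Nat.choose_self, Nat.cast_one,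
          mul_one, smul_eq_mul, mul_eq_zero] at h
        refine h.resolve_left ?_
        exact_mod_cast natCast_ne_zero_of_lt (k := k) (p := p) (a := t + 1) (by omega) (by omega)
      · intro t' _ ht'
        rw [if_neg, zero_smul, LinearMap.zero_apply]
        intro h'
        apply ht'
        ext
        push_cast at h'
        omega
      · simp
      · intro s' _ hs'
        rw [LinearMap.sum_apply]
        refine Finset.sum_eq_zero fun t' _ => ?_
        rcases lt_or_gt_of_ne (fun h => hs' (Fin.ext h) : (s' : ℕ) ≠ s) with hlt | hgt
        · rw [Nat.choose_eq_zero_of_lt (by omega)]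
          simp
        · rw [LinearMap.smul_apply, ← hB, ih (p - 2 - s') (by omega) s' t' (by omega), smul_zero]
      · simp
  rw [← B.forall_coord_eq_zero_iff]
  rintro ⟨s, t⟩
  exact main (p - 2 - s) s t (by omega)

lemma transverseCoeff_tensorOp_of_mem [CharP k p] (hp : p.Prime) {q t : ℕ} (hq : 1 ≤ q)
    (hqp : q < p) (hqt : q + t ≤ p) {w : (Fin (p - 1) → k) ⊗[k] (Fin (p - 1) → k)}
    (hw : w ∈ diagonalFiltration p k t) {n : ℤ} (hn : n < p) {κ : ℤ} (hκ : -1 ≤ κ) :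
    transverseCoeff p k q n (tensorOp p k κ w) =
      ((n + 1 + (κ + 1) * q : ℤ) : k) * transverseCoeff p k q (n - κ) w := by
  obtain ⟨c, hc⟩ := Int.eq_ofNat_of_zero_le (show 0 ≤ κ + 1 by omega)
  obtain rfl : κ = c - 1 := by omega
  rw [transverseCoeff_tensorOp hp hq hqp hn, Finset.sum_eq_zero, add_zero, sub_add_cancel,
    show n + 1 - (c : ℤ) = n - (c - 1) by ring]
  intro l hl
  have hl := Finset.mem_range.1 hl
  rcases Nat.lt_or_ge c (l + 2) with hcl | hcl
  · simp [Nat.choose_eq_zero_of_lt hcl]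
  · rw [hw (q - 1 - l) (by omega) (by omega) _ (by omega), mul_zero]

lemma tensorOp_mem_diagonalFiltration [CharP k p] (hp : p.Prime) {t : ℕ}
    {w : (Fin (p - 1) → k) ⊗[k] (Fin (p - 1) → k)} (hw : w ∈ diagonalFiltration p k t)
    {κ : ℤ} (hκ : -1 ≤ κ) : tensorOp p k κ w ∈ diagonalFiltration p k t := by
  intro q hq hqt n hn
  rw [transverseCoeff_tensorOp_of_mem hp hq (by omega) (by omega) hw hn hκ]
  rcases lt_or_ge (n - κ) p with h | h
  · rw [hw q hq hqt _ h, mul_zero]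
  · obtain rfl : κ = -1 := by omega
    obtain rfl : n = p - 1 := by omega
    simp

/-- The `q`-th transverse derivative along the diagonal, with values in `Z(q)`. -/
noncomputable def transverseDeriv (p : ℕ) (k : Type) [Field k] (q : ℕ) :
    ((Fin (p - 1) → k) ⊗[k] (Fin (p - 1) → k)) →ₗ[k] (Fin p → k) :=
  LinearMap.pi fun n => transverseCoeff p k q n

lemma vermaOp_transverseDeriv [CharP k p] (q : ℕ) (lam : ℤ) {κ : ℤ} (hκ : -1 ≤ κ)
    (w : (Fin (p - 1) → k) ⊗[k] (Fin (p - 1) → k)) (n : Fin p) :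
    vermaOp p k lam κ (transverseDeriv p k q w) n =
      (((n : ℤ) + 1 + (κ + 1) * lam : ℤ) : k) * transverseCoeff p k q (n - κ) w := by
  simp only [vermaOp, Matrix.toLin'_apply, Matrix.mulVec, dotProduct, Matrix.of_apply,
    transverseDeriv, LinearMap.pi_apply, ite_mul, zero_mul]
  by_cases h : 0 ≤ (n : ℤ) - κ ∧ (n : ℤ) - κ < p
  · obtain ⟨j, hj⟩ := Int.eq_ofNat_of_zero_le h.1
    rw [Finset.sum_eq_single (⟨j, by omega⟩ : Fin p)]
    · simp [hj]
    · intro i _ hi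
      rw [if_neg]
      intro h'
      exact hi (Fin.ext (by simp only; omega))
    · simp
  · rw [Finset.sum_eq_zero fun i _ => if_neg (by omega)]
    rcases lt_or_ge ((n : ℤ) - κ) 0 with h0 | h0
    · rw [transverseCoeff_of_neg q h0, LinearMap.zero_apply, mul_zero]
    · obtain rfl : κ = -1 := by omega
      have hn : (n : ℤ) + 1 = p := by omega
      simp [hn]

lemma vermaOp_single (lam κ : ℤ) (j n : Fin p) (h : (j : ℤ) = n - κ) :
    vermaOp p k lam κ (Pi.single j 1) =
      (((n : ℤ) + 1 + (κ + 1) * lam : ℤ) : k) • (Pi.single n 1 : Fin p → k) := by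
  ext i
  simp only [vermaOp, Matrix.toLin'_apply, Matrix.mulVec_single_one, Matrix.col_apply,
    Matrix.of_apply, Pi.smul_apply, Pi.single_apply, smul_eq_mul, mul_ite, mul_one, mul_zero]
  have : ((j : ℤ) = (i : ℤ) - κ) ↔ i = n := by
    rw [Fin.ext_iff]
    omega
  simp only [this]
  split_ifs with hi
  · rw [hi]
  · rfl

/-- The vector `m_0` generates `Z(q)` for `1 ≤ q ≤ p - 2`. -/
lemma eq_top_of_vermaOp_mem [CharP k p] (hp : p.Prime) (hp3 : 3 < p) {q : ℕ} (hq : 1 ≤ q)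
    (hqp : q + 2 ≤ p) {S : Submodule k (Fin p → k)}
    (hS : ∀ κ : ℤ, -1 ≤ κ → κ ≤ (p : ℤ) - 2 → ∀ v ∈ S, vermaOp p k q κ v ∈ S)
    (h0 : Pi.single ⟨0, hp.pos⟩ 1 ∈ S) : S = ⊤ := by
  have hcast {a : ℕ} (ha : ¬ p ∣ a) : (a : k) ≠ 0 := by
    rwa [Ne, CharP.cast_eq_zero_iff k p]
  have hlow (n : Fin p) (hn : (n : ℕ) + 2 ≤ p) : Pi.single n 1 ∈ S := by
    have h := hS n (by omega) (by omega) _ h0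
    rw [vermaOp_single _ _ _ n (by simp)] at h
    refine (S.smul_mem_iff ?_).1 h
    have hd : ¬ p ∣ (n + 1) * (q + 1) := by
      rw [hp.dvd_mul, not_or]
      exact ⟨Nat.not_dvd_of_pos_of_lt (by omega) (by omega),
        Nat.not_dvd_of_pos_of_lt (by omega) (by omega)⟩
    have := hcast hd
    push_cast at this ⊢
    convert this using 1
    ring
  have hall (n : Fin p) : Pi.single n 1 ∈ S := by
    by_cases hn : (n : ℕ) + 2 ≤ p
    · exact hlow n hn
    have h := hS 1 (by omega) (by omega) _ (hlow ⟨p - 2, by omega⟩ (by simp only; omega))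
    rw [vermaOp_single _ _ _ n (by simp only; omega)] at h
    refine (S.smul_mem_iff ?_).1 h
    have hd : ¬ p ∣ 2 * q := by
      rw [hp.dvd_mul, not_or]
      exact ⟨Nat.not_dvd_of_pos_of_lt (by omega) (by omega),
        Nat.not_dvd_of_pos_of_lt (by omega) (by omega)⟩
    have hn1 : (n : ℤ) + 1 = p := by omega
    have := hcast hd
    rw [hn1]
    push_cast at this ⊢
    rw [CharP.cast_eq_zero k p]
    convert this using 1
    ring
  rw [eq_top_iff, ← (Pi.basisFun k (Fin p)).span_eq, Submodule.span_le]
  rintro _ ⟨n, rfl⟩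
  simpa using hall n

lemma transverseDeriv_tensorOp [CharP k p] (hp : p.Prime) {q t : ℕ} (hq : 1 ≤ q)
    (hqp : q < p) (hqt : q + t ≤ p) {w : (Fin (p - 1) → k) ⊗[k] (Fin (p - 1) → k)}
    (hw : w ∈ diagonalFiltration p k t) {κ : ℤ} (hκ : -1 ≤ κ) :
    transverseDeriv p k q (tensorOp p k κ w) = vermaOp p k q κ (transverseDeriv p k q w) := by
  ext n
  rw [vermaOp_transverseDeriv q q hκ]
  exact transverseCoeff_tensorOp_of_mem hp hq hqp hqt hw (by omega) hκ

lemma diagonalPower_mem [CharP k p] (hp : p.Prime) {q t : ℕ} (hqp : q < p) (hqt : p ≤ q + t) :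
    diagonalPower p k q ∈ diagonalFiltration p k t := by
  intro r hr hrt n hn
  rw [transverseCoeff_diagonalPower hp hqp hr (by omega) hn, if_neg (by omega)]

lemma map_transverseDeriv [CharP k p] (hp : p.Prime) (hp3 : 3 < p) {q t : ℕ} (hq : 1 ≤ q)
    (hqp : q + 2 ≤ p) (hqt : q + t = p) :
    Submodule.map (transverseDeriv p k q) (diagonalFiltration p k t) = ⊤ := by
  apply eq_top_of_vermaOp_mem hp hp3 hq hqp
  · rintro κ hκ - _ ⟨w, hw, rfl⟩
    exact ⟨tensorOp p k κ w, tensorOp_mem_diagonalFiltration hp hw hκ,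
      transverseDeriv_tensorOp hp hq (by omega) hqt.le hw hκ⟩
  · have hq0 : (q : k) ≠ 0 := natCast_ne_zero_of_lt (p := p) hq (by omega)
    refine ⟨(q : k) • diagonalPower p k q,
      Submodule.smul_mem _ _ (diagonalPower_mem hp (by omega) hqt.ge), ?_⟩
    ext n
    rw [map_smul, Pi.smul_apply, transverseDeriv, LinearMap.pi_apply,
      transverseCoeff_diagonalPower hp (by omega) hq le_rfl (by omega), Pi.single_apply]
    simp only [true_and, Fin.ext_iff, Nat.cast_eq_zero, smul_eq_mul]
    split_ifs
    · exact mul_inv_cancel₀ hq0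
    · exact mul_zero _

lemma mem_diagonalFiltration_iff {q t : ℕ} (hq : 1 ≤ q) (hqt : q + t + 1 = p)
    {w : (Fin (p - 1) → k) ⊗[k] (Fin (p - 1) → k)} :
    w ∈ diagonalFiltration p k t ↔
      w ∈ diagonalFiltration p k (t + 1) ∧
        ∀ n : ℤ, 0 ≤ n → n < p → transverseCoeff p k q n w = 0 := by
  constructor
  · intro hw
    exact ⟨diagonalFiltration_mono t.le_succ hw, fun n _ hn => hw q hq (by omega) n hn⟩
  · rintro ⟨hw, h⟩ r hr hrt n hn
    rcases lt_or_ge n 0 with h0 | h0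
    · rw [transverseCoeff_of_neg r h0, LinearMap.zero_apply]
    rcases Nat.lt_or_ge r q with hrq | hrq
    · exact hw r hr (by omega) n hn
    · obtain rfl : r = q := by omega
      exact h n h0 hn

lemma inf_ker_transverseDeriv {q t : ℕ} (hq : 1 ≤ q) (hqt : q + t + 1 = p) :
    diagonalFiltration p k (t + 1) ⊓ LinearMap.ker (transverseDeriv p k q) =
      diagonalFiltration p k t := by
  ext w
  rw [mem_diagonalFiltration_iff hq hqt, Submodule.mem_inf, LinearMap.mem_ker]
  refine and_congr_right fun _ => ⟨fun h n h0 hn => ?_, fun h => ?_⟩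
  · obtain ⟨m, rfl⟩ := Int.eq_ofNat_of_zero_le h0
    exact congrFun h (⟨m, by omega⟩ : Fin p)
  · ext n
    exact h n (by omega) (by omega)

/-- On the bottom piece of the filtration the last transverse derivative is constant. -/
lemma transverseCoeff_eq_zero_of_mem_one [CharP k p] (hp : p.Prime)
    {w : (Fin (p - 1) → k) ⊗[k] (Fin (p - 1) → k)} (hw : w ∈ diagonalFiltration p k 1)
    {n : ℤ} (h0 : 0 < n) (hn : n < p) : transverseCoeff p k (p - 1) n w = 0 := by
  have hp1 := hp.one_lt
  have h := transverseCoeff_tensorOp_of_mem hp (q := p - 1) (by omega) (by omega) (by omega) hw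
    (n := p - 1) (by omega) (κ := p - 1 - n) (by omega)
  rw [transverseCoeff_top, LinearMap.zero_apply, eq_comm, mul_eq_zero, sub_sub_cancel] at h
  refine h.resolve_left ?_
  obtain ⟨m, rfl⟩ := Int.eq_ofNat_of_zero_le h0.le
  have hm : (m : k) ≠ 0 := natCast_ne_zero_of_lt (p := p) (by omega) (by omega)
  rw [Nat.cast_sub hp1.le]
  push_cast
  rw [CharP.cast_eq_zero k p]
  convert hm using 1
  ring_nf

lemma transverseCoeff_tensorOp_of_mem_one [CharP k p] (hp : p.Prime)
    {w : (Fin (p - 1) → k) ⊗[k] (Fin (p - 1) → k)} (hw : w ∈ diagonalFiltration p k 1)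
    {κ : ℤ} (hκ : -1 ≤ κ) : transverseCoeff p k (p - 1) 0 (tensorOp p k κ w) = 0 := by
  have hp1 := hp.one_lt
  rw [transverseCoeff_tensorOp_of_mem hp (by omega) (by omega) (by omega) hw (by omega) hκ]
  rcases lt_trichotomy κ 0 with h | rfl | h
  · rw [transverseCoeff_eq_zero_of_mem_one hp hw (by omega) (by omega), mul_zero]
  · rw [Nat.cast_sub hp1.le]
    simp
  · rw [transverseCoeff_of_neg _ (by omega), LinearMap.zero_apply, mul_zero]

lemma map_transverseCoeff_one [CharP k p] (hp : p.Prime) :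
    Submodule.map (transverseCoeff p k (p - 1) 0) (diagonalFiltration p k 1) = ⊤ := by
  have hp1 := hp.one_lt
  have hq0 : ((p - 1 : ℕ) : k) ≠ 0 := natCast_ne_zero_of_lt (p := p) (by omega) (by omega)
  rw [eq_top_iff]
  rintro c -
  refine ⟨(c * ((p - 1 : ℕ) : k)) • diagonalPower p k (p - 1),
    Submodule.smul_mem _ _ (diagonalPower_mem hp (by omega) (by omega)), ?_⟩
  rw [map_smul, transverseCoeff_diagonalPower hp (by omega) (by omega) le_rfl (by omega),
    if_pos ⟨rfl, rfl⟩, smul_eq_mul, mul_inv_cancel_right₀ hq0]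

lemma inf_ker_transverseCoeff_one [CharP k p] (hp : p.Prime) :
    diagonalFiltration p k 1 ⊓ LinearMap.ker (transverseCoeff p k (p - 1) 0) =
      diagonalFiltration p k 0 := by
  have hp1 := hp.one_lt
  ext w
  rw [mem_diagonalFiltration_iff (q := p - 1) (t := 0) (by omega) (by omega), Submodule.mem_inf,
    LinearMap.mem_ker]
  refine and_congr_right fun hw => ⟨fun h n h0 hn => ?_, fun h => h 0 le_rfl (by omega)⟩
  rcases h0.eq_or_lt with rfl | h0
  · exact h
  · exact transverseCoeff_eq_zero_of_mem_one hp hw h0 hn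

end WittTensor

/-- in the Grothendieck group of restricted `W(1)`-modules,
`[L(p-1) ⊗ L(p-1)] = [L(0)] + [L(1)] + ⋯ + [L(p-2)]`: the tensor square has a
composition series of length `p-1` whose factors are, in some order `σ`, the simple
modules `L(0)` (trivial one-dimensional), `L(1), …, L(p-2)` (the simple Verma modules
`Z(λ)`).  Each factor `N_{t+1}/N_t` is exhibited by a linear map `φ` defined on the
ambient space which is surjective from `N_{t+1}` onto `L(σ t)`, has `N_t` as kernel
inside `N_{t+1}`, and intertwines the `W(1)`-actions. -/
theorem tensor_square_composition_factors (p : ℕ) (k : Type) [Field k] [IsAlgClosed k]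
    [CharP k p] (hp : p.Prime) (hp3 : 3 < p) :
    ∃ (N : Fin ((p - 1) + 1) → Submodule k ((Fin (p - 1) → k) ⊗[k] (Fin (p - 1) → k)))
      (σ : Equiv.Perm (Fin (p - 1))),
      Monotone N ∧ N 0 = ⊥ ∧ N (Fin.last (p - 1)) = ⊤ ∧
      (∀ a : Fin ((p - 1) + 1), ∀ κ : ℤ, -1 ≤ κ → κ ≤ (p : ℤ) - 2 →
        ∀ w ∈ N a, tensorOp p k κ w ∈ N a) ∧
      (∀ t : Fin (p - 1),
        if (σ t : ℕ) = 0 then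
          -- the factor `N_{t+1}/N_t` is the one-dimensional trivial module `L(0)`
          ∃ φ : ((Fin (p - 1) → k) ⊗[k] (Fin (p - 1) → k)) →ₗ[k] k,
            Submodule.map φ (N t.succ) = ⊤ ∧
            N t.succ ⊓ LinearMap.ker φ = N t.castSucc ∧
            (∀ κ : ℤ, -1 ≤ κ → κ ≤ (p : ℤ) - 2 →
              ∀ w ∈ N t.succ, φ (tensorOp p k κ w) = 0)
        else
          -- the factor `N_{t+1}/N_t` is the simple module `L(σ t) = Z(σ t)`
          ∃ φ : ((Fin (p - 1) → k) ⊗[k] (Fin (p - 1) → k)) →ₗ[k] (Fin p → k),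
            Submodule.map φ (N t.succ) = ⊤ ∧
            N t.succ ⊓ LinearMap.ker φ = N t.castSucc ∧
            (∀ κ : ℤ, -1 ≤ κ → κ ≤ (p : ℤ) - 2 →
              ∀ w ∈ N t.succ, φ (tensorOp p k κ w) = vermaOp p k (σ t : ℕ) κ (φ w))) := by
  have : NeZero (p - 1) := ⟨by omega⟩
  refine ⟨fun a => WittTensor.diagonalFiltration p k a, Equiv.neg (Fin (p - 1)),
    fun a b hab => WittTensor.diagonalFiltration_mono hab, WittTensor.diagonalFiltration_zero,
    WittTensor.diagonalFiltration_eq_top,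
    fun a κ hκ _ w hw => WittTensor.tensorOp_mem_diagonalFiltration hp hw hκ, fun t => ?_⟩
  have hval : ((Equiv.neg (Fin (p - 1)) t : Fin (p - 1)) : ℕ) =
      if (t : ℕ) = 0 then 0 else p - 1 - t := by
    rw [Equiv.neg_apply, Fin.val_neg]
    simp only [Fin.ext_iff, Fin.val_zero]
  simp only [Fin.val_succ, Fin.val_castSucc]
  rw [hval]
  have ht := t.2
  by_cases h : (t : ℕ) = 0
  · rw [if_pos h, if_pos rfl, h]
    exact ⟨WittTensor.transverseCoeff p k (p - 1) 0, WittTensor.map_transverseCoeff_one hp,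
      WittTensor.inf_ker_transverseCoeff_one hp,
      fun κ hκ _ w hw => WittTensor.transverseCoeff_tensorOp_of_mem_one hp hw hκ⟩
  · rw [if_neg h, if_neg (by omega)]
    exact ⟨WittTensor.transverseDeriv p k (p - 1 - t),
      WittTensor.map_transverseDeriv hp hp3 (by omega) (by omega) (by omega),
      WittTensor.inf_ker_transverseDeriv (by omega) (by omega),
      fun κ hκ _ w hw =>
        WittTensor.transverseDeriv_tensorOp hp (by omega) (by omega) (by omega) hw hκ⟩
end
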